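/- Let f ∈ 𝓒 and θ ∈ ℝ, and let π be drawn from Q_{n,f,θ}. Then (1/n) ∑_{i=1}^n f(i/n, π(i)/n) converges in probability to μ_{f,θ}[f]: for every ε > 0, Q_{n,f,θ}({π ∈ S_n : |(1/n) ∑_{i=1}^n f(i/n, π(i)/n) − μ_{f,θ}[f]| > ε}) → 0 as n → ∞. -/

import Mathlib

open MeasureTheory Filter Topology
open scoped ENNReal

noncomputable section

/-- The unit square `[0,1]²` in `ℝ × ℝ`. -/
def unitSq : Set (ℝ × ℝ) := Set.Icc 0 1 ×ˢ Set.Icc 0 1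

/-- Lebesgue measure restricted to `[0,1]`. -/
def unif01 : Measure ℝ := volume.restrict (Set.Icc 0 1)

/-- Lebesgue (uniform) measure on the unit square. -/
def usq : Measure (ℝ × ℝ) := unif01.prod unif01

/-- `𝓜`: Borel probability measures on `[0,1]²` with both marginals Lebesgue on `[0,1]`. -/
def MM : Set (Measure (ℝ × ℝ)) :=
  {μ | IsProbabilityMeasure μ ∧ μ.map Prod.fst = unif01 ∧ μ.map Prod.snd = unif01}

/-- The class `𝓒` of continuous functions on the unit square, not identically zero,
with all row and column integrals vanishing. -/
def memC (f : ℝ × ℝ → ℝ) : Prop :=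
  ContinuousOn f unitSq ∧ (∃ p ∈ unitSq, f p ≠ 0) ∧
    (∀ x ∈ Set.Icc (0 : ℝ) 1, (∫ z in (0 : ℝ)..1, f (x, z)) = 0) ∧
    (∀ y ∈ Set.Icc (0 : ℝ) 1, (∫ z in (0 : ℝ)..1, f (z, y)) = 0)

open scoped Classical in
/-- Kullback–Leibler divergence `D(μ‖ν)`, equal to `∫ log(dμ/dν) dμ` when `μ ≪ ν`
(and this integral exists), and `+∞` otherwise. -/
def KL (μ ν : Measure (ℝ × ℝ)) : ℝ≥0∞ :=
  if μ ≪ ν ∧ Integrable (fun x => Real.log ((μ.rnDeriv ν x).toReal)) μ then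
    ENNReal.ofReal (∫ x, Real.log ((μ.rnDeriv ν x).toReal) ∂μ)
  else ⊤

/-- The objective `θ μ[f] − D(μ‖u)`, as an extended real. -/
def objE (f : ℝ × ℝ → ℝ) (θ : ℝ) (μ : Measure (ℝ × ℝ)) : EReal :=
  ((θ * ∫ p, f p ∂μ : ℝ) : EReal) - (KL μ usq : EReal)

/-- `∑_{i=1}^n f(i/n, π(i)/n)`. -/
def permStat (f : ℝ × ℝ → ℝ) (n : ℕ) (π : Equiv.Perm (Fin n)) : ℝ :=
  ∑ i : Fin n, f ((i.1 + 1 : ℝ) / n, ((π i).1 + 1 : ℝ) / n)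

/-- The log normalizing constant `Z_n(f,θ)`. -/
def Zn (f : ℝ × ℝ → ℝ) (θ : ℝ) (n : ℕ) : ℝ :=
  Real.log (∑ π : Equiv.Perm (Fin n), Real.exp (θ * permStat f n π))

open scoped Classical in
/-- The probability that a sample from `Q_{n,f,θ}` satisfies `p`. -/
def Qprob (f : ℝ × ℝ → ℝ) (θ : ℝ) (n : ℕ) (p : Equiv.Perm (Fin n) → Prop) : ℝ :=
  ∑ π : Equiv.Perm (Fin n), if p π then Real.exp (θ * permStat f n π - Zn f θ n) else 0

/-- The summand measuring the failure of detailed balance under exchanging the images of `i` and `j`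
in the Gibbs measure on permutations with energy `∑ i, G i (π i)`. -/
def swapTerm {ι : Type*} (G : ι → ι → ℝ) (a b : ι → ℝ) (π : Equiv.Perm ι) (i j : ι) : ℝ :=
  a i * (b (π i) - b (π j)) * Real.exp (-G i (π i) - G j (π j))

lemma exp_energy_mul_swap {ι : Type*} [Fintype ι] [DecidableEq ι] (G : ι → ι → ℝ)
    (π : Equiv.Perm ι) {i j : ι} (hij : i ≠ j) :
    Real.exp (∑ k, G k ((π * Equiv.swap i j) k)) * Real.exp (-G i (π j) - G j (π i)) =
      Real.exp (∑ k, G k (π k)) * Real.exp (-G i (π i) - G j (π j)) := by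
  rw [← Real.exp_add, ← Real.exp_add]
  congr 1
  have key : ∀ σ : Equiv.Perm ι, ∑ k, G k (σ k) =
      G i (σ i) + (G j (σ j) + ∑ k ∈ (Finset.univ.erase i).erase j, G k (σ k)) := fun σ ↦ by
    rw [Finset.add_sum_erase _ (fun k ↦ G k (σ k)) (by simp [hij.symm]),
      Finset.add_sum_erase _ (fun k ↦ G k (σ k)) (Finset.mem_univ i)]
  rw [key, key π]
  have : ∑ k ∈ (Finset.univ.erase i).erase j, G k ((π * Equiv.swap i j) k) =
      ∑ k ∈ (Finset.univ.erase i).erase j, G k (π k) := by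
    refine Finset.sum_congr rfl fun k hk ↦ ?_
    simp only [Finset.mem_erase] at hk
    rw [Equiv.Perm.mul_apply, Equiv.swap_apply_of_ne_of_ne hk.2.1 hk.1]
  rw [this]
  simp only [Equiv.Perm.mul_apply, Equiv.swap_apply_left, Equiv.swap_apply_right]
  ring

lemma sum_exp_mul_swapTerm_mul_eq_zero {ι : Type*} [Fintype ι] [DecidableEq ι] (G : ι → ι → ℝ)
    (a b : ι → ℝ) (H : Equiv.Perm ι → ℝ) (i j : ι)
    (hH : ∀ π, H (π * Equiv.swap i j) = H π) :
    ∑ π : Equiv.Perm ι, Real.exp (∑ k, G k (π k)) * (swapTerm G a b π i j * H π) = 0 := by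
  rcases eq_or_ne i j with rfl | hij
  · simp [swapTerm]
  set S := ∑ π : Equiv.Perm ι, Real.exp (∑ k, G k (π k)) * (swapTerm G a b π i j * H π) with hS
  have h : S = -S := by
    conv_lhs => rw [hS, ← Equiv.sum_comp (Equiv.mulRight (Equiv.swap i j))]
    rw [hS, ← Finset.sum_neg_distrib]
    refine Finset.sum_congr rfl fun π _ ↦ ?_
    have := exp_energy_mul_swap G π hij
    simp only [Equiv.coe_mulRight, hH, swapTerm]
    simp only [Equiv.Perm.mul_apply, Equiv.swap_apply_left, Equiv.swap_apply_right] at this ⊢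
    linear_combination a i * (b (π j) - b (π i)) * H π * this
  linarith

lemma sum_exp_mul_sq_sum_swapTerm_le {ι : Type*} [Fintype ι] [DecidableEq ι] (G : ι → ι → ℝ)
    (a b : ι → ℝ) {C : ℝ} (hC : ∀ π i j, |swapTerm G a b π i j| ≤ C) :
    ∑ π : Equiv.Perm ι, Real.exp (∑ k, G k (π k)) * (∑ i, ∑ j, swapTerm G a b π i j) ^ 2 ≤
      4 * Fintype.card ι ^ 3 * C ^ 2 * ∑ π : Equiv.Perm ι, Real.exp (∑ k, G k (π k)) := by
  set W := ∑ π : Equiv.Perm ι, Real.exp (∑ k, G k (π k)) with hW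
  have hW0 : 0 ≤ W := Finset.sum_nonneg fun _ _ ↦ (Real.exp_pos _).le
  have expand : ∑ π : Equiv.Perm ι,
      Real.exp (∑ k, G k (π k)) * (∑ i, ∑ j, swapTerm G a b π i j) ^ 2 =
      ∑ i, ∑ j, ∑ k, ∑ l, ∑ π : Equiv.Perm ι, Real.exp (∑ k, G k (π k)) *
        (swapTerm G a b π i j * swapTerm G a b π k l) := by
    have h1 : ∀ π : Equiv.Perm ι,
        Real.exp (∑ k, G k (π k)) * (∑ i, ∑ j, swapTerm G a b π i j) ^ 2 =
        ∑ i, ∑ j, ∑ k, ∑ l, Real.exp (∑ k, G k (π k)) *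
        (swapTerm G a b π i j * swapTerm G a b π k l) := fun π ↦ by
      rw [sq, Finset.sum_mul, Finset.mul_sum]
      refine Finset.sum_congr rfl fun i _ ↦ ?_
      rw [Finset.sum_mul, Finset.mul_sum]
      refine Finset.sum_congr rfl fun j _ ↦ ?_
      simp only [Finset.mul_sum]
    simp only [h1]
    rw [Finset.sum_comm]
    refine Finset.sum_congr rfl fun i _ ↦ ?_
    rw [Finset.sum_comm]
    refine Finset.sum_congr rfl fun j _ ↦ ?_
    rw [Finset.sum_comm]
    refine Finset.sum_congr rfl fun k _ ↦ ?_
    rw [Finset.sum_comm]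
  have bound : ∀ i j k l, ∑ π : Equiv.Perm ι, Real.exp (∑ k, G k (π k)) *
        (swapTerm G a b π i j * swapTerm G a b π k l) ≤
      C ^ 2 * W * ((if k = i then 1 else 0) + (if k = j then 1 else 0) +
        (if l = i then 1 else 0) + (if l = j then 1 else 0)) := fun i j k l ↦ by
    by_cases h : (k = i ∨ k = j) ∨ (l = i ∨ l = j)
    · have h1 : ∑ π : Equiv.Perm ι, Real.exp (∑ k, G k (π k)) *
          (swapTerm G a b π i j * swapTerm G a b π k l) ≤ C ^ 2 * W := by
        rw [hW, Finset.mul_sum]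
        refine Finset.sum_le_sum fun π _ ↦ ?_
        rw [mul_comm]
        refine mul_le_mul_of_nonneg_right ?_ (Real.exp_pos _).le
        refine (le_abs_self _).trans ?_
        rw [abs_mul, sq]
        exact mul_le_mul (hC _ _ _) (hC _ _ _) (abs_nonneg _) ((abs_nonneg _).trans (hC π i j))
      refine h1.trans (le_mul_of_one_le_right (by positivity) ?_)
      rcases h with (h | h) | (h | h) <;> simp only [h, if_true] <;> split_ifs <;> norm_num
    · push Not at h
      rw [sum_exp_mul_swapTerm_mul_eq_zero]
      · simp [h.1.1, h.1.2, h.2.1, h.2.2]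
      · intro π
        simp only [swapTerm, Equiv.Perm.mul_apply,
          Equiv.swap_apply_of_ne_of_ne h.1.1 h.1.2, Equiv.swap_apply_of_ne_of_ne h.2.1 h.2.2]
  rw [expand]
  refine (Finset.sum_le_sum fun i _ ↦ Finset.sum_le_sum fun j _ ↦ Finset.sum_le_sum fun k _ ↦
    Finset.sum_le_sum fun l _ ↦ bound i j k l).trans (le_of_eq ?_)
  simp only [← Finset.mul_sum, Finset.sum_add_distrib, Finset.sum_ite_eq',
    Finset.sum_const, Finset.card_univ, Finset.mem_univ, if_true, nsmul_eq_mul]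
  ring

instance : IsProbabilityMeasure unif01 :=
  ⟨by simp [unif01]⟩

instance : IsProbabilityMeasure usq := by
  unfold usq; infer_instance

lemma integrable_of_abs_le {α : Type*} [MeasurableSpace α] {μ : Measure α} [IsFiniteMeasure μ]
    {g : α → ℝ} (hg : Measurable g) {C : ℝ} (hC : ∀ x, |g x| ≤ C) : Integrable g μ :=
  Integrable.of_bound hg.aestronglyMeasurable C (ae_of_all _ hC)

lemma integrable_exp_of_abs_le {α : Type*} [MeasurableSpace α] {μ : Measure α} [IsFiniteMeasure μ]
    {g : α → ℝ} (hg : Measurable g) {C : ℝ} (hC : ∀ x, |g x| ≤ C) :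
    Integrable (fun x ↦ Real.exp (g x)) μ :=
  integrable_of_abs_le (C := Real.exp C) hg.exp fun x ↦ by
    rw [abs_of_pos (Real.exp_pos _)]
    exact Real.exp_le_exp.2 ((le_abs_self _).trans (hC x))

lemma tilted_le_smul {α : Type*} [MeasurableSpace α] (μ : Measure α) [IsProbabilityMeasure μ]
    {g : α → ℝ} (hg : Measurable g) {C : ℝ} (hC : ∀ x, |g x| ≤ C) :
    μ.tilted g ≤ ENNReal.ofReal (Real.exp (2 * C)) • μ := by
  have hlow : Real.exp (-C) ≤ ∫ x, Real.exp (g x) ∂μ := by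
    have := integral_mono (μ := μ) (integrable_const (Real.exp (-C)))
      (integrable_exp_of_abs_le hg hC) fun x ↦ Real.exp_le_exp.2 (abs_le.1 (hC x)).1
    simpa using this
  rw [Measure.tilted, ← withDensity_const]
  refine withDensity_mono (ae_of_all _ fun x ↦ ENNReal.ofReal_le_ofReal ?_)
  rw [div_le_iff₀ ((Real.exp_pos _).trans_le hlow)]
  calc Real.exp (g x) ≤ Real.exp (2 * C) * Real.exp (-C) := by
        rw [← Real.exp_add]
        exact Real.exp_le_exp.2 (by linarith [(abs_le.1 (hC x)).2])
    _ ≤ _ := by gcongr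

lemma withDensity_exp_eq_tilted {α : Type*} [MeasurableSpace α] (μ : Measure α)
    [IsFiniteMeasure μ] {g : α → ℝ} (hg : Measurable g) {C : ℝ} (hC : ∀ x, |g x| ≤ C)
    (h : IsProbabilityMeasure (μ.withDensity fun x ↦ ENNReal.ofReal (Real.exp (g x)))) :
    μ.withDensity (fun x ↦ ENNReal.ofReal (Real.exp (g x))) = μ.tilted g := by
  have h1 := h.measure_univ
  rw [withDensity_apply _ MeasurableSet.univ, Measure.restrict_univ,
    ← ofReal_integral_eq_lintegral_ofReal (integrable_exp_of_abs_le hg hC)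
      (ae_of_all _ fun _ ↦ (Real.exp_pos _).le), ENNReal.ofReal_eq_one] at h1
  simp [Measure.tilted, h1]

lemma exists_eq_withDensity_exp {α : Type*} [MeasurableSpace α] (P ρ : Measure α)
    [IsFiniteMeasure P] [IsFiniteMeasure ρ] {C : ℝ}
    (h1 : ρ ≤ ENNReal.ofReal (Real.exp C) • P) (h2 : P ≤ ENNReal.ofReal (Real.exp C) • ρ) :
    ∃ A : α → ℝ, Measurable A ∧ (∀ x, |A x| ≤ |C|) ∧
      ρ = P.withDensity (fun x ↦ ENNReal.ofReal (Real.exp (A x))) := by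
  have hac : ρ ≪ P := Measure.absolutelyContinuous_of_le_smul h1
  have hup : ρ.rnDeriv P ≤ᵐ[P] fun _ ↦ ENNReal.ofReal (Real.exp C) := by
    refine ae_le_of_forall_setLIntegral_le_of_sigmaFinite (Measure.measurable_rnDeriv _ _)
      fun s _ _ ↦ ?_
    rw [Measure.setLIntegral_rnDeriv hac, setLIntegral_const]
    simpa using h1 s
  have hlow : (fun _ ↦ ENNReal.ofReal (Real.exp (-C))) ≤ᵐ[P] ρ.rnDeriv P := by
    refine ae_le_of_forall_setLIntegral_le_of_sigmaFinite measurable_const fun s _ _ ↦ ?_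
    rw [Measure.setLIntegral_rnDeriv hac, setLIntegral_const]
    calc ENNReal.ofReal (Real.exp (-C)) * P s
        ≤ ENNReal.ofReal (Real.exp (-C)) * (ENNReal.ofReal (Real.exp C) * ρ s) := by
          gcongr; simpa using h2 s
      _ = ρ s := by
          rw [← mul_assoc, ← ENNReal.ofReal_mul (Real.exp_pos _).le, ← Real.exp_add]
          simp
  refine ⟨fun x ↦ max (-|C|) (min |C| (Real.log (ρ.rnDeriv P x).toReal)), ?_, fun x ↦ ?_, ?_⟩
  · have := Measure.measurable_rnDeriv ρ P
    fun_prop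
  · exact abs_le.2 ⟨le_max_left _ _, max_le (by linarith [abs_nonneg C]) (min_le_left _ _)⟩
  · rw [← Measure.withDensity_rnDeriv_eq ρ P hac]
    refine withDensity_congr_ae ?_
    rw [Measure.withDensity_rnDeriv_eq ρ P hac]
    filter_upwards [hup, hlow] with x hx hx'
    have hfin : ρ.rnDeriv P x ≠ ∞ := ne_top_of_le_ne_top ENNReal.ofReal_ne_top hx
    have hu : (ρ.rnDeriv P x).toReal ≤ Real.exp C :=
      ENNReal.toReal_le_of_le_ofReal (Real.exp_pos _).le hx
    have hl : Real.exp (-C) ≤ (ρ.rnDeriv P x).toReal :=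
      (ENNReal.ofReal_le_iff_le_toReal hfin).1 hx'
    have hpos : 0 < (ρ.rnDeriv P x).toReal := (Real.exp_pos _).trans_le hl
    have hu' := (Real.log_le_iff_le_exp hpos).2 hu
    have hl' := (Real.le_log_iff_exp_le hpos).2 hl
    rw [min_eq_right (hu'.trans (le_abs_self C)),
      max_eq_right (by linarith [le_abs_self C]), Real.exp_log hpos, ENNReal.ofReal_toReal hfin]

/-- A coupling of the uniform measures whose exponential tilt by `-G` is a product measure
has a log-density which is `G` plus functions of the separate variables. -/
lemma exists_eq_tilted_of_mem_MM {G : ℝ × ℝ → ℝ} (hG : Measurable G) {C : ℝ}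
    (hC : ∀ p, |G p| ≤ C) {ν : Measure (ℝ × ℝ)} (hν : ν ∈ MM)
    (hprod : ∀ a b : BoundedContinuousFunction ℝ ℝ,
      (∫ p, a p.1 * b p.2 * Real.exp (-G p) ∂ν) * ∫ p, Real.exp (-G p) ∂ν =
        (∫ p, a p.1 * Real.exp (-G p) ∂ν) * ∫ p, b p.2 * Real.exp (-G p) ∂ν) :
    ∃ A B : ℝ → ℝ, Measurable A ∧ Measurable B ∧ (∃ K, (∀ x, |A x| ≤ K) ∧ ∀ x, |B x| ≤ K) ∧
      ν = usq.tilted (fun p ↦ A p.1 + B p.2 + G p) := by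
  obtain ⟨hprob, hfst, hsnd⟩ := hν
  have hnC : ∀ p, |(-G) p| ≤ C := fun p ↦ by simpa using hC p
  have hintn : Integrable (fun p ↦ Real.exp ((-G) p)) ν := integrable_exp_of_abs_le hG.neg hnC
  set ρ := ν.tilted (-G) with hρ
  have : IsProbabilityMeasure ρ := isProbabilityMeasure_tilted hintn
  have hνρ : ν = ρ.tilted G := by
    have := tilted_neg_same (f := -G) (μ := ν) hintn
    rwa [neg_neg, eq_comm] at this
  have h1 : ρ ≤ ENNReal.ofReal (Real.exp (2 * C)) • ν := tilted_le_smul ν hG.neg hnC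
  have h2 : ν ≤ ENNReal.ofReal (Real.exp (2 * C)) • ρ := by
    conv_lhs => rw [hνρ]
    exact tilted_le_smul ρ hG hC
  have hmap : ∀ {h : ℝ × ℝ → ℝ}, Measurable h → ν.map h = unif01 →
      ∃ A : ℝ → ℝ, Measurable A ∧ (∀ x, |A x| ≤ |2 * C|) ∧
      ρ.map h = unif01.withDensity (fun x ↦ ENNReal.ofReal (Real.exp (A x))) := by
    intro h hh hνh
    have := Measure.isProbabilityMeasure_map (μ := ρ) hh.aemeasurable
    refine exists_eq_withDensity_exp _ _ (C := 2 * C) ?_ ?_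
    · rw [← hνh, ← Measure.map_smul]
      exact Measure.map_mono h1 hh
    · rw [← hνh, ← Measure.map_smul]
      exact Measure.map_mono h2 hh
  obtain ⟨A, hA, hAC, hA'⟩ := hmap measurable_fst hfst
  obtain ⟨B, hB, hBC, hB'⟩ := hmap measurable_snd hsnd
  have hABC : ∀ p : ℝ × ℝ, |A p.1 + B p.2| ≤ |2 * C| + |2 * C| := fun p ↦
    (abs_add_le _ _).trans (add_le_add (hAC _) (hBC _))
  have hABm : Measurable fun p : ℝ × ℝ ↦ A p.1 + B p.2 := by fun_prop
  refine ⟨A, B, hA, hB, ⟨_, hAC, hBC⟩, ?_⟩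
  have hρprod : ρ = (ρ.map Prod.fst).prod (ρ.map Prod.snd) := by
    have := Measure.isProbabilityMeasure_map (μ := ρ) (f := Prod.fst) measurable_fst.aemeasurable
    have := Measure.isProbabilityMeasure_map (μ := ρ) (f := Prod.snd) measurable_snd.aemeasurable
    refine Measure.eq_prod_of_integral_mul_boundedContinuousFunction fun a b ↦ ?_
    rw [integral_map measurable_fst.aemeasurable a.continuous.aestronglyMeasurable,
      integral_map measurable_snd.aemeasurable b.continuous.aestronglyMeasurable,
      hρ, integral_tilted, integral_tilted, integral_tilted]
    have hpos : 0 < ∫ p, Real.exp (-G p) ∂ν := integral_exp_pos hintn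
    have hp := hprod a b
    simp only [Pi.neg_apply, smul_eq_mul, div_mul_eq_mul_div, integral_div]
    simp only [mul_comm (Real.exp _)]
    field_simp
    linarith
  have hρtilt : ρ = usq.tilted (fun p ↦ A p.1 + B p.2) := by
    have key : ρ = usq.withDensity (fun p ↦ ENNReal.ofReal (Real.exp (A p.1 + B p.2))) := by
      rw [hρprod, hA', hB', prod_withDensity (by fun_prop) (by fun_prop), usq]
      congr 1 with p
      rw [Real.exp_add, ENNReal.ofReal_mul (Real.exp_pos _).le]
    rw [key]
    exact withDensity_exp_eq_tilted _ hABm hABC (by rwa [← key])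
  rw [hνρ, hρtilt, tilted_tilted (integrable_exp_of_abs_le hABm hABC)]
  rfl

/-- A maximizer of the objective agrees with any coupling whose log-density is `θ F` plus
functions of the separate variables. -/
lemma eq_tilted_of_forall_objE_le {f F : ℝ × ℝ → ℝ} {θ : ℝ} (hF : Measurable F) {C : ℝ}
    (hC : ∀ p, |F p| ≤ C) (hfF : ∀ μ ∈ MM, ∫ p, f p ∂μ = ∫ p, F p ∂μ)
    {A B : ℝ → ℝ} (hA : Measurable A) (hB : Measurable B) {K : ℝ} (hAK : ∀ x, |A x| ≤ K)
    (hBK : ∀ x, |B x| ≤ K) {ν μ : Measure (ℝ × ℝ)} (hνM : ν ∈ MM) (hμM : μ ∈ MM)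
    (hν : ν = usq.tilted (fun p ↦ A p.1 + B p.2 + θ * F p))
    (hle : objE f θ ν ≤ objE f θ μ) : μ = ν := by
  set g : ℝ × ℝ → ℝ := fun p ↦ A p.1 + B p.2 + θ * F p with hg
  have hgm : Measurable g := by fun_prop
  have hgC : ∀ p, |g p| ≤ K + K + |θ| * C := fun p ↦ by
    refine (abs_add_le _ _).trans (add_le_add
      ((abs_add_le _ _).trans (add_le_add (hAK _) (hBK _))) ?_)
    rw [abs_mul]
    exact mul_le_mul_of_nonneg_left (hC p) (abs_nonneg _)
  have hexp : Integrable (fun p ↦ Real.exp (g p)) usq := integrable_exp_of_abs_le hgm hgC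
  set κ : ℝ := (∫ x, A x ∂unif01) + ∫ x, B x ∂unif01 with hκ
  set L : ℝ := Real.log (∫ p, Real.exp (g p) ∂usq) with hL
  have hint : ∀ η ∈ MM, ∫ p, g p ∂η = κ + θ * ∫ p, f p ∂η := by
    rintro η hη
    have := hη.1
    have hA1 : ∫ p, A p.1 ∂η = ∫ x, A x ∂unif01 := by
      rw [← hη.2.1, integral_map measurable_fst.aemeasurable hA.aestronglyMeasurable]
    have hB1 : ∫ p, B p.2 ∂η = ∫ x, B x ∂unif01 := by
      rw [← hη.2.2, integral_map measurable_snd.aemeasurable hB.aestronglyMeasurable]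
    have iA : Integrable (fun p : ℝ × ℝ ↦ A p.1) η :=
      integrable_of_abs_le (by fun_prop) fun p ↦ hAK _
    have iB : Integrable (fun p : ℝ × ℝ ↦ B p.2) η :=
      integrable_of_abs_le (by fun_prop) fun p ↦ hBK _
    have iF : Integrable (fun p : ℝ × ℝ ↦ θ * F p) η :=
      (integrable_of_abs_le hF hC).const_mul θ
    calc ∫ p, g p ∂η = ∫ p, (A p.1 + B p.2) + θ * F p ∂η := rfl
      _ = κ + θ * ∫ p, f p ∂η := by
        rw [integral_add (by exact iA.add iB) iF, integral_add iA iB, integral_const_mul, hA1, hB1,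
          hfF η hη]
  have hνP := hνM.1
  have hμP := hμM.1
  have hνac : ν ≪ usq := by rw [hν]; exact tilted_absolutelyContinuous _ _
  have hllr : llr ν usq =ᵐ[ν] fun p ↦ g p - L := by
    have := log_rnDeriv_tilted_left_self (μ := usq) hexp
    rw [← hν] at this
    exact hνac this
  have hllr_int : ∫ p, llr ν usq p ∂ν = κ + θ * (∫ p, f p ∂ν) - L := by
    rw [integral_congr_ae hllr, integral_sub (integrable_of_abs_le hgm hgC) (integrable_const _),
      hint ν hνM]
    simp
  have hKLν : KL ν usq = ENNReal.ofReal (κ + θ * (∫ p, f p ∂ν) - L) := by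
    have h1 : Integrable (llr ν usq) ν :=
      (integrable_congr hllr).2 ((integrable_of_abs_le hgm hgC).sub (integrable_const _))
    rw [KL, if_pos ⟨hνac, h1⟩]
    exact congrArg ENNReal.ofReal hllr_int
  have hnn : 0 ≤ κ + θ * (∫ p, f p ∂ν) - L := by
    rw [← hllr_int, ← InformationTheory.toReal_klDiv_of_measure_eq hνac (by simp)]
    exact ENNReal.toReal_nonneg
  have hobjν : objE f θ ν = ((L - κ : ℝ) : EReal) := by
    rw [objE, hKLν, EReal.coe_ennreal_ofReal, max_eq_left hnn, ← EReal.coe_sub]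
    congr 1; ring
  rw [hobjν, objE] at hle
  by_cases hcond : μ ≪ usq ∧ Integrable (fun x ↦ Real.log ((μ.rnDeriv usq x).toReal)) μ
  swap
  · rw [KL, if_neg hcond] at hle
    simp at hle
    rw [← EReal.coe_sub] at hle
    exact absurd hle (EReal.coe_ne_bot _)
  rw [KL, if_pos hcond, EReal.coe_ennreal_ofReal, ← EReal.coe_sub, EReal.coe_le_coe_iff] at hle
  obtain ⟨hμac, hμint⟩ := hcond
  change Integrable (llr μ usq) μ at hμint
  have hup : ∫ p, llr μ usq p ∂μ ≤ θ * (∫ p, f p ∂μ) - (L - κ) :=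
    (le_max_left _ 0).trans (by
      change max (∫ p, llr μ usq p ∂μ) 0 ≤ _
      change _ ≤ _ - max (∫ p, llr μ usq p ∂μ) 0 at hle
      linarith)
  have hgμ : Integrable g μ := integrable_of_abs_le hgm hgC
  have hint' : Integrable (llr μ ν) μ := by
    rw [hν]; exact integrable_llr_tilted_right hμac hgμ hμint hexp
  have hacν : μ ≪ ν := hμac.trans (by rw [hν]; exact absolutelyContinuous_tilted hexp)
  have hzero : (InformationTheory.klDiv μ ν).toReal ≤ 0 := by
    rw [InformationTheory.toReal_klDiv_of_measure_eq hacν (by simp), hν,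
      integral_llr_tilted_right hμac hgμ hexp hμint, hint μ hμM]
    linarith
  have := (ENNReal.toReal_eq_zero_iff _).1 (le_antisymm hzero ENNReal.toReal_nonneg)
  exact InformationTheory.klDiv_eq_zero_iff.1
    (this.resolve_right (InformationTheory.klDiv_ne_top hacν hint'))

lemma tendsto_riemannSum {a : ℝ → ℝ} (ha : Continuous a) :
    Tendsto (fun n : ℕ ↦ (∑ i : Fin n, a ((i.1 + 1 : ℝ) / n)) / n) atTop
      (𝓝 (∫ x, a x ∂unif01)) := by
  have hI : ∫ x, a x ∂unif01 = ∫ x in (0 : ℝ)..1, a x := by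
    rw [unif01, intervalIntegral.integral_of_le zero_le_one, integral_Icc_eq_integral_Ioc]
  rw [hI, Metric.tendsto_atTop]
  intro ε hε
  obtain ⟨η, hη, hu⟩ := Metric.uniformContinuousOn_iff.1
    (isCompact_Icc.uniformContinuousOn_of_continuous ha.continuousOn :
      UniformContinuousOn a (Set.Icc 0 1)) (ε / 2) (half_pos hε)
  obtain ⟨N, hN⟩ := exists_nat_one_div_lt hη
  refine ⟨N + 1, fun n hn ↦ ?_⟩
  have hn0 : (0 : ℝ) < n := by exact_mod_cast (Nat.succ_pos N).trans_le hn
  have hnη : 1 / (n : ℝ) < η := by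
    refine lt_of_le_of_lt (one_div_le_one_div_of_le (by positivity) ?_) hN
    exact_mod_cast hn
  have hsplit : ∫ x in (0 : ℝ)..1, a x =
      ∑ i ∈ Finset.range n, ∫ x in ((i : ℝ) / n)..((i + 1 : ℕ) : ℝ) / n, a x := by
    have h := intervalIntegral.sum_integral_adjacent_intervals (f := a) (μ := volume)
      (a := fun k : ℕ ↦ (k : ℝ) / n) (n := n) fun k _ ↦ ha.intervalIntegrable _ _
    rw [h]
    simp [hn0.ne']
  rw [Real.dist_eq, Fin.sum_univ_eq_sum_range (fun i ↦ a ((i + 1 : ℝ) / n)), Finset.sum_div,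
    hsplit, ← Finset.sum_sub_distrib]
  have hterm : ∀ i ∈ Finset.range n, |a ((i + 1 : ℝ) / n) / n -
      ∫ x in ((i : ℝ) / n)..((i + 1 : ℕ) : ℝ) / n, a x| ≤ ε / 2 * (1 / n) := by
    intro i hi
    have hi' : (i : ℝ) + 1 ≤ n := by exact_mod_cast Finset.mem_range.1 hi
    have hlen : ((i + 1 : ℕ) : ℝ) / n - (i : ℝ) / n = 1 / n := by push_cast; ring
    have h1 : a ((i + 1 : ℝ) / n) / n = ∫ x in ((i : ℝ) / n)..((i + 1 : ℕ) : ℝ) / n,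
        a ((i + 1 : ℝ) / n) := by
      rw [intervalIntegral.integral_const, hlen, smul_eq_mul]; ring
    rw [h1, ← intervalIntegral.integral_sub intervalIntegrable_const (ha.intervalIntegrable _ _)]
    have h2 := intervalIntegral.norm_integral_le_of_norm_le_const
      (a := (i : ℝ) / n) (b := ((i + 1 : ℕ) : ℝ) / n) (C := ε / 2)
      (f := fun x ↦ a ((i + 1 : ℝ) / n) - a x) ?_
    · rwa [hlen, abs_of_pos (by positivity)] at h2
    · intro x hx
      rw [Set.uIoc_of_le (by gcongr; simp)] at hx
      push_cast at hx
      have hi0 : 0 ≤ (i : ℝ) / n := by positivity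
      have hi1 : ((i : ℝ) + 1) / n ≤ 1 := (div_le_one hn0).2 hi'
      refine (hu _ ⟨by positivity, hi1⟩ _ ⟨hi0.trans hx.1.le, hx.2.trans hi1⟩ ?_).le
      rw [Real.dist_eq, abs_of_nonneg (by linarith [hx.2])]
      have : ((i : ℝ) + 1) / n = (i : ℝ) / n + 1 / n := by ring
      linarith [hx.1]
  calc _ ≤ ∑ i ∈ Finset.range n, ε / 2 * (1 / n) :=
        (Finset.abs_sum_le_sum_abs _ _).trans (Finset.sum_le_sum hterm)
    _ = ε / 2 := by
        rw [Finset.sum_const, Finset.card_range, nsmul_eq_mul]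
        field_simp
    _ < ε := half_lt_self hε

/-- The empirical measure of the graph of a permutation, rescaled to the unit square. -/
def permMeasure (n : ℕ) (π : Equiv.Perm (Fin n)) : Measure (ℝ × ℝ) :=
  (n : ℝ≥0∞)⁻¹ • ∑ i : Fin n, Measure.dirac ((i.1 + 1 : ℝ) / n, ((π i).1 + 1 : ℝ) / n)

lemma integral_permMeasure {n : ℕ} (π : Equiv.Perm (Fin n)) (g : ℝ × ℝ → ℝ) :
    ∫ p, g p ∂permMeasure n π =
      (∑ i : Fin n, g ((i.1 + 1 : ℝ) / n, ((π i).1 + 1 : ℝ) / n)) / n := by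
  rw [permMeasure, integral_smul_measure, integral_finsetSum_measure fun i _ ↦
    integrable_dirac (by simp)]
  simp [div_eq_inv_mul]

lemma isProbabilityMeasure_permMeasure {n : ℕ} (hn : n ≠ 0) (π : Equiv.Perm (Fin n)) :
    IsProbabilityMeasure (permMeasure n π) := by
  refine ⟨?_⟩
  simp [permMeasure, ENNReal.inv_mul_cancel, hn]

lemma div_mem_Icc {n : ℕ} (i : Fin n) : ((i.1 + 1 : ℝ) / n) ∈ Set.Icc (0 : ℝ) 1 := by
  refine ⟨by positivity, div_le_one_of_le₀ ?_ (by positivity)⟩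
  exact_mod_cast i.2

lemma permMeasure_compl_unitSq {n : ℕ} (π : Equiv.Perm (Fin n)) :
    permMeasure n π unitSqᶜ = 0 := by
  have hm : MeasurableSet unitSq := measurableSet_Icc.prod measurableSet_Icc
  have : ∀ i : Fin n, (((i.1 + 1 : ℝ) / n, ((π i).1 + 1 : ℝ) / n) : ℝ × ℝ) ∈ unitSq :=
    fun i ↦ ⟨div_mem_Icc i, div_mem_Icc (π i)⟩
  simp [permMeasure, hm.compl, this]

lemma isCompact_closure_supported_unitSq :
    IsCompact (closure {ν : ProbabilityMeasure (ℝ × ℝ) | (ν : Measure (ℝ × ℝ)) unitSqᶜ = 0}) := by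
  refine isCompact_closure_of_isTightMeasureSet
    (isTightMeasureSet_iff_exists_isCompact_measure_compl_le.2 fun ε _ ↦
      ⟨unitSq, isCompact_Icc.prod isCompact_Icc, ?_⟩)
  rintro _ ⟨ν, hν, rfl⟩
  exact (le_of_eq hν).trans zero_le

lemma Qprob_nonneg (f : ℝ × ℝ → ℝ) (θ : ℝ) (n : ℕ) (p : Equiv.Perm (Fin n) → Prop) :
    0 ≤ Qprob f θ n p :=
  Finset.sum_nonneg fun _ _ ↦ by split_ifs <;> positivity

lemma Qprob_mono (f : ℝ × ℝ → ℝ) (θ : ℝ) {n : ℕ} {p q : Equiv.Perm (Fin n) → Prop}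
    (h : ∀ π, p π → q π) : Qprob f θ n p ≤ Qprob f θ n q := by
  classical
  refine Finset.sum_le_sum fun π _ ↦ ?_
  by_cases hp : p π
  · rw [if_pos hp, if_pos (h π hp)]
  · rw [if_neg hp]
    split_ifs <;> positivity

lemma Qprob_or_le (f : ℝ × ℝ → ℝ) (θ : ℝ) {n : ℕ} (p q : Equiv.Perm (Fin n) → Prop) :
    Qprob f θ n (fun π ↦ p π ∨ q π) ≤ Qprob f θ n p + Qprob f θ n q := by
  classical
  rw [Qprob, Qprob, Qprob, ← Finset.sum_add_distrib]
  refine Finset.sum_le_sum fun π _ ↦ ?_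
  have := (Real.exp_pos (θ * permStat f n π - Zn f θ n)).le
  by_cases hp : p π <;> by_cases hq : q π <;> simp [hp, hq, this]

lemma Qprob_eq_zero (f : ℝ × ℝ → ℝ) (θ : ℝ) {n : ℕ} {p : Equiv.Perm (Fin n) → Prop}
    (h : ∀ π, ¬ p π) : Qprob f θ n p = 0 :=
  Finset.sum_eq_zero fun π _ ↦ if_neg (h π)

lemma Qprob_le_of_swapTerm (f : ℝ × ℝ → ℝ) (θ : ℝ) {n : ℕ} (hn : n ≠ 0)
    {p : Equiv.Perm (Fin n) → Prop} (a b : Fin n → ℝ) {C δ : ℝ} (hδ : 0 < δ)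
    (hC : ∀ π i j, |swapTerm (fun i j : Fin n ↦
      θ * f ((i.1 + 1 : ℝ) / n, (j.1 + 1 : ℝ) / n)) a b π i j| ≤ C)
    (hp : ∀ π, p π → δ < |(∑ i, ∑ j, swapTerm (fun i j : Fin n ↦
      θ * f ((i.1 + 1 : ℝ) / n, (j.1 + 1 : ℝ) / n)) a b π i j) / n ^ 2|) :
    Qprob f θ n p ≤ 4 * C ^ 2 / δ ^ 2 / n := by
  classical
  have hn0 : (0 : ℝ) < n := by exact_mod_cast Nat.pos_of_ne_zero hn
  set G : Fin n → Fin n → ℝ := fun i j ↦ θ * f ((i.1 + 1 : ℝ) / n, (j.1 + 1 : ℝ) / n) with hG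
  have hGf : ∀ π : Equiv.Perm (Fin n), θ * permStat f n π = ∑ k, G k (π k) := fun π ↦ by
    rw [permStat, Finset.mul_sum]
  set W := ∑ π : Equiv.Perm (Fin n), Real.exp (∑ k, G k (π k)) with hW
  have hWpos : 0 < W := Finset.sum_pos (fun _ _ ↦ Real.exp_pos _) Finset.univ_nonempty
  have hmain := sum_exp_mul_sq_sum_swapTerm_le G a b hC
  rw [← hW, Fintype.card_fin] at hmain
  have hQ : Qprob f θ n p * W ≤ ∑ π : Equiv.Perm (Fin n), Real.exp (∑ k, G k (π k)) *
      (∑ i, ∑ j, swapTerm G a b π i j) ^ 2 / (δ ^ 2 * n ^ 4) := by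
    rw [Qprob, Finset.sum_mul]
    refine Finset.sum_le_sum fun π _ ↦ ?_
    by_cases h : p π
    · have h1 : δ * n ^ 2 < |∑ i, ∑ j, swapTerm G a b π i j| := by
        have := hp π h
        rwa [abs_div, abs_of_pos (by positivity : (0 : ℝ) < (n : ℝ) ^ 2),
          lt_div_iff₀ (by positivity)] at this
      have h2 : δ ^ 2 * n ^ 4 ≤ (∑ i, ∑ j, swapTerm G a b π i j) ^ 2 := by
        rw [← sq_abs (∑ i, ∑ j, swapTerm G a b π i j)]
        calc δ ^ 2 * (n : ℝ) ^ 4 = (δ * n ^ 2) ^ 2 := by ring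
          _ ≤ _ := by gcongr
      have hZ : Zn f θ n = Real.log W := by simp only [Zn, hGf, hW]
      rw [if_pos h, Real.exp_sub, hZ, Real.exp_log hWpos, hGf, div_mul_cancel₀ _ hWpos.ne',
        le_div_iff₀ (by positivity)]
      gcongr
    · rw [if_neg h, zero_mul]
      positivity
  rw [← Finset.sum_div] at hQ
  have h3 := hQ.trans (div_le_div_of_nonneg_right hmain (by positivity))
  have h4 : 4 * (n : ℝ) ^ 3 * C ^ 2 * W / (δ ^ 2 * n ^ 4) = 4 * C ^ 2 / δ ^ 2 / n * W := by
    field_simp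
  rw [h4] at h3
  exact le_of_mul_le_mul_right h3 hWpos

lemma exists_boundedContinuous_extension {f : ℝ × ℝ → ℝ} (hf : ContinuousOn f unitSq) :
    ∃ F : BoundedContinuousFunction (ℝ × ℝ) ℝ, ∀ p ∈ unitSq, F p = f p := by
  set c : ℝ × ℝ → ℝ × ℝ := fun p ↦ (max 0 (min 1 p.1), max 0 (min 1 p.2)) with hc
  have hmem : ∀ p, c p ∈ unitSq := fun p ↦
    ⟨⟨le_max_left _ _, max_le zero_le_one (min_le_left _ _)⟩,
      ⟨le_max_left _ _, max_le zero_le_one (min_le_left _ _)⟩⟩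
  have hcont : Continuous (f ∘ c) := hf.comp_continuous (by fun_prop) hmem
  obtain ⟨C, hC⟩ :=
    (isCompact_Icc.prod isCompact_Icc : IsCompact unitSq).exists_bound_of_continuousOn hf
  refine ⟨.ofNormedAddCommGroup (f ∘ c) hcont C fun p ↦ hC _ (hmem p), fun p hp ↦ ?_⟩
  have : c p = p := by
    obtain ⟨⟨h1, h2⟩, ⟨h3, h4⟩⟩ := hp
    simp [hc, h1, h2, h3, h4]
  simp [this]

lemma integral_eq_of_mem_MM {f F : ℝ × ℝ → ℝ} (h : ∀ p ∈ unitSq, F p = f p)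
    {μ : Measure (ℝ × ℝ)} (hμ : μ ∈ MM) : ∫ p, f p ∂μ = ∫ p, F p ∂μ := by
  have hI : ∀ᵐ x ∂unif01, x ∈ Set.Icc (0 : ℝ) 1 := ae_restrict_mem measurableSet_Icc
  have h1 : ∀ᵐ p ∂μ, p.1 ∈ Set.Icc (0 : ℝ) 1 :=
    ae_of_ae_map measurable_fst.aemeasurable (by rw [hμ.2.1]; exact hI)
  have h2 : ∀ᵐ p ∂μ, p.2 ∈ Set.Icc (0 : ℝ) 1 :=
    ae_of_ae_map measurable_snd.aemeasurable (by rw [hμ.2.2]; exact hI)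
  refine integral_congr_ae ?_
  filter_upwards [h1, h2] with p hp1 hp2
  exact (h p ⟨hp1, hp2⟩).symm

/-- A functional of probability measures is negligible if its value at the empirical measure of
a permutation drawn from `Q_{n,f,θ}` tends to `0` in probability. -/
def Negligible (f : ℝ × ℝ → ℝ) (θ : ℝ) (Φ : ProbabilityMeasure (ℝ × ℝ) → ℝ) : Prop :=
  ∀ δ > 0, Tendsto (fun n : ℕ ↦ Qprob f θ n
    (fun π ↦ ∃ ν : ProbabilityMeasure (ℝ × ℝ), δ < |Φ ν| ∧ (ν : Measure (ℝ × ℝ)) = permMeasure n π))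
    atTop (𝓝 0)

lemma negligible_of_tendsto_sub {f : ℝ × ℝ → ℝ} {θ : ℝ} {Φ : ProbabilityMeasure (ℝ × ℝ) → ℝ}
    {u : ℕ → ℝ} (hu : Tendsto u atTop (𝓝 0))
    (h : ∀ (n : ℕ) (π : Equiv.Perm (Fin n)) (ν : ProbabilityMeasure (ℝ × ℝ)),
      (ν : Measure (ℝ × ℝ)) = permMeasure n π → Φ ν = u n) : Negligible f θ Φ := by
  intro δ hδ
  refine tendsto_const_nhds.congr' ?_
  filter_upwards [Metric.tendsto_atTop'.1 hu δ hδ |>.elim fun N hN ↦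
    (eventually_gt_atTop N).mono fun n hn ↦ hN n hn] with n hn
  rw [Qprob_eq_zero]
  rintro π ⟨ν, hν, hνπ⟩
  rw [h n π ν hνπ] at hν
  rw [Real.dist_eq, sub_zero] at hn
  exact lt_asymm hn hν

lemma negligible_fst (f : ℝ × ℝ → ℝ) (θ : ℝ) (a : BoundedContinuousFunction ℝ ℝ) :
    Negligible f θ (fun ν ↦ ∫ p, a p.1 ∂(ν : Measure (ℝ × ℝ)) - ∫ x, a x ∂unif01) := by
  refine negligible_of_tendsto_sub (u := fun n : ℕ ↦
    (∑ i : Fin n, a ((i.1 + 1 : ℝ) / n)) / n - ∫ x, a x ∂unif01) ?_ fun n π ν hν ↦ ?_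
  · simpa using (tendsto_riemannSum a.continuous).sub_const (∫ x, a x ∂unif01)
  · simp only [hν]
    rw [integral_permMeasure]

lemma negligible_snd (f : ℝ × ℝ → ℝ) (θ : ℝ) (a : BoundedContinuousFunction ℝ ℝ) :
    Negligible f θ (fun ν ↦ ∫ p, a p.2 ∂(ν : Measure (ℝ × ℝ)) - ∫ x, a x ∂unif01) := by
  refine negligible_of_tendsto_sub (u := fun n : ℕ ↦
    (∑ i : Fin n, a ((i.1 + 1 : ℝ) / n)) / n - ∫ x, a x ∂unif01) ?_ fun n π ν hν ↦ ?_
  · simpa using (tendsto_riemannSum a.continuous).sub_const (∫ x, a x ∂unif01)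
  · simp only [hν]
    rw [integral_permMeasure, Equiv.sum_comp π (fun i : Fin n ↦ a ((i.1 + 1 : ℝ) / n))]

lemma negligible_balance {f : ℝ × ℝ → ℝ} (θ : ℝ) {F : BoundedContinuousFunction (ℝ × ℝ) ℝ}
    (hF : ∀ p ∈ unitSq, F p = f p) (a b : BoundedContinuousFunction ℝ ℝ) :
    Negligible f θ (fun ν ↦
      (∫ p, a p.1 * b p.2 * Real.exp (-(θ * F p)) ∂(ν : Measure (ℝ × ℝ))) *
        (∫ p, Real.exp (-(θ * F p)) ∂(ν : Measure (ℝ × ℝ))) -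
      (∫ p, a p.1 * Real.exp (-(θ * F p)) ∂(ν : Measure (ℝ × ℝ))) *
        ∫ p, b p.2 * Real.exp (-(θ * F p)) ∂(ν : Measure (ℝ × ℝ))) := by
  intro δ hδ
  set C : ℝ := ‖a‖ * (2 * ‖b‖) * Real.exp (2 * (|θ| * ‖F‖)) with hCdef
  refine squeeze_zero' (Eventually.of_forall fun n ↦ Qprob_nonneg _ _ _ _) ?_
    (tendsto_const_div_atTop_nhds_zero_nat (4 * C ^ 2 / δ ^ 2))
  filter_upwards [eventually_ne_atTop 0] with n hn
  have hn0 : (n : ℝ) ≠ 0 := by exact_mod_cast hn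
  have hFf : ∀ i j : Fin n, F ((i.1 + 1 : ℝ) / n, (j.1 + 1 : ℝ) / n) =
      f ((i.1 + 1 : ℝ) / n, (j.1 + 1 : ℝ) / n) := fun i j ↦ hF _ ⟨div_mem_Icc i, div_mem_Icc j⟩
  refine Qprob_le_of_swapTerm f θ hn (fun i ↦ a ((i.1 + 1 : ℝ) / n))
    (fun j ↦ b ((j.1 + 1 : ℝ) / n)) (C := C) hδ (fun π i j ↦ ?_) ?_
  · have hG : ∀ i j : Fin n, -(θ * f ((i.1 + 1 : ℝ) / n, (j.1 + 1 : ℝ) / n)) ≤ |θ| * ‖F‖ :=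
      fun i j ↦ by
        refine (neg_le_abs _).trans ?_
        rw [abs_mul, ← hFf]
        exact mul_le_mul_of_nonneg_left (F.norm_coe_le_norm _) (abs_nonneg _)
    rw [swapTerm, abs_mul, abs_mul, abs_of_pos (Real.exp_pos _), hCdef]
    gcongr
    · exact a.norm_coe_le_norm _
    · rw [two_mul]
      exact (abs_sub _ _).trans (add_le_add (b.norm_coe_le_norm _) (b.norm_coe_le_norm _))
    · linarith [hG i (π i), hG j (π j)]
  · rintro π ⟨ν, hν, hνπ⟩
    refine hν.trans_eq (congrArg _ ?_)
    simp only [hνπ, integral_permMeasure, hFf]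
    rw [div_mul_div_comm, div_mul_div_comm, ← sub_div, ← sq, Finset.sum_mul_sum,
      Finset.sum_mul_sum, ← Finset.sum_sub_distrib]
    congr 1
    have hswap : ∀ i j : Fin n, swapTerm (fun i j : Fin n ↦
        θ * f ((i.1 + 1 : ℝ) / n, (j.1 + 1 : ℝ) / n)) (fun i ↦ a ((i.1 + 1 : ℝ) / n))
        (fun j ↦ b ((j.1 + 1 : ℝ) / n)) π i j =
        a ((i.1 + 1 : ℝ) / n) * (b (((π i).1 + 1 : ℝ) / n) - b (((π j).1 + 1 : ℝ) / n)) *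
        (Real.exp (-(θ * f ((i.1 + 1 : ℝ) / n, ((π i).1 + 1 : ℝ) / n))) *
          Real.exp (-(θ * f ((j.1 + 1 : ℝ) / n, ((π j).1 + 1 : ℝ) / n)))) := fun i j ↦ by
      rw [swapTerm, ← Real.exp_add, ← sub_eq_add_neg]
    refine Finset.sum_congr rfl fun i _ ↦ ?_
    rw [← Finset.sum_sub_distrib]
    refine Finset.sum_congr rfl fun j _ ↦ ?_
    rw [hswap]
    ring

lemma mem_MM_of_integral_eq {ν : Measure (ℝ × ℝ)} [IsProbabilityMeasure ν]
    (h1 : ∀ a : BoundedContinuousFunction ℝ ℝ, ∫ p, a p.1 ∂ν = ∫ x, a x ∂unif01)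
    (h2 : ∀ a : BoundedContinuousFunction ℝ ℝ, ∫ p, a p.2 ∂ν = ∫ x, a x ∂unif01) : ν ∈ MM := by
  refine ⟨inferInstance, ?_, ?_⟩
  · have := Measure.isProbabilityMeasure_map (μ := ν) (f := Prod.fst) measurable_fst.aemeasurable
    refine ext_of_forall_integral_eq_of_IsFiniteMeasure fun a ↦ ?_
    rw [integral_map measurable_fst.aemeasurable a.continuous.aestronglyMeasurable, h1]
  · have := Measure.isProbabilityMeasure_map (μ := ν) (f := Prod.snd) measurable_snd.aemeasurable
    refine ext_of_forall_integral_eq_of_IsFiniteMeasure fun a ↦ ?_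
    rw [integral_map measurable_snd.aemeasurable a.continuous.aestronglyMeasurable, h2]

/-- A probability measure annihilated by all continuous negligible functionals is the maximizer. -/
lemma eq_of_forall_negligible {f : ℝ × ℝ → ℝ} {θ : ℝ} {F : BoundedContinuousFunction (ℝ × ℝ) ℝ}
    (hF : ∀ p ∈ unitSq, F p = f p) {μ : Measure (ℝ × ℝ)} (hμ : μ ∈ MM)
    (hmax : ∀ ν ∈ MM, objE f θ ν ≤ objE f θ μ) {ν : ProbabilityMeasure (ℝ × ℝ)}
    (hν : ∀ Φ : ProbabilityMeasure (ℝ × ℝ) → ℝ, Continuous Φ → Negligible f θ Φ → Φ ν = 0) :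
    μ = ν := by
  have hFC : ∀ p, |F p| ≤ ‖F‖ := F.norm_coe_le_norm
  have hθFC : ∀ p, |θ * F p| ≤ |θ| * ‖F‖ := fun p ↦ by
    rw [abs_mul]
    exact mul_le_mul_of_nonneg_left (hFC p) (abs_nonneg _)
  have hcont : ∀ {g : ℝ × ℝ → ℝ}, Continuous g → (∃ C, ∀ p, |g p| ≤ C) →
      Continuous fun ν : ProbabilityMeasure (ℝ × ℝ) ↦ ∫ p, g p ∂(ν : Measure (ℝ × ℝ)) :=
    fun {g} hg ⟨C, hC⟩ ↦ ProbabilityMeasure.continuous_integral_boundedContinuousFunction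
      (BoundedContinuousFunction.ofNormedAddCommGroup g hg C hC)
  have hνM : (ν : Measure (ℝ × ℝ)) ∈ MM := by
    refine mem_MM_of_integral_eq (fun a ↦ sub_eq_zero.1 ?_) fun a ↦ sub_eq_zero.1 ?_
    · exact hν _ ((hcont (by fun_prop) ⟨‖a‖, fun p ↦ a.norm_coe_le_norm _⟩).sub continuous_const)
        (negligible_fst f θ a)
    · exact hν _ ((hcont (by fun_prop) ⟨‖a‖, fun p ↦ a.norm_coe_le_norm _⟩).sub continuous_const)
        (negligible_snd f θ a)
  have hw : ∀ p, |Real.exp (-(θ * F p))| ≤ Real.exp (|θ| * ‖F‖) := fun p ↦ by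
    rw [abs_of_pos (Real.exp_pos _)]
    exact Real.exp_le_exp.2 ((neg_le_abs _).trans (hθFC p))
  have hbal : ∀ a b : BoundedContinuousFunction ℝ ℝ,
      (∫ p, a p.1 * b p.2 * Real.exp (-(θ * F p)) ∂(ν : Measure (ℝ × ℝ))) *
        (∫ p, Real.exp (-(θ * F p)) ∂(ν : Measure (ℝ × ℝ))) =
      (∫ p, a p.1 * Real.exp (-(θ * F p)) ∂(ν : Measure (ℝ × ℝ))) *
        ∫ p, b p.2 * Real.exp (-(θ * F p)) ∂(ν : Measure (ℝ × ℝ)) := fun a b ↦ by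
    have ha : ∀ x, |a x| ≤ ‖a‖ := a.norm_coe_le_norm
    have hb : ∀ x, |b x| ≤ ‖b‖ := b.norm_coe_le_norm
    refine sub_eq_zero.1 (hν _ (Continuous.sub (Continuous.mul ?_ ?_) (Continuous.mul ?_ ?_))
      (negligible_balance θ hF a b))
    · refine hcont (by fun_prop) ⟨‖a‖ * ‖b‖ * Real.exp (|θ| * ‖F‖), fun p ↦ ?_⟩
      rw [abs_mul, abs_mul]
      gcongr
      exacts [ha _, hb _, hw p]
    · exact hcont (by fun_prop) ⟨_, hw⟩
    · refine hcont (by fun_prop) ⟨‖a‖ * Real.exp (|θ| * ‖F‖), fun p ↦ ?_⟩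
      rw [abs_mul]
      gcongr
      exacts [ha _, hw p]
    · refine hcont (by fun_prop) ⟨‖b‖ * Real.exp (|θ| * ‖F‖), fun p ↦ ?_⟩
      rw [abs_mul]
      gcongr
      exacts [hb _, hw p]
  have hFm : Measurable F := F.continuous.measurable
  obtain ⟨A, B, hA, hB, ⟨K, hAK, hBK⟩, hνt⟩ :=
    exists_eq_tilted_of_mem_MM (G := fun p ↦ θ * F p) (hFm.const_mul θ) hθFC hνM hbal
  exact eq_tilted_of_forall_objE_le hFm hFC (fun η hη ↦ integral_eq_of_mem_MM hF hη) hA hB hAK hBK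
    hνM hμ hνt (hmax _ hνM)

/-- For `f ∈ 𝓒`, `θ ∈ ℝ` and `π ∼ Q_{n,f,θ}`, the statistic
`(1/n) ∑ f(i/n, π(i)/n)` converges in probability to `μ_{f,θ}[f]`. -/
theorem statistic_converges_in_probability (f : ℝ × ℝ → ℝ) (hf : memC f) (θ : ℝ)
    (μstar : Measure (ℝ × ℝ)) (hμ : μstar ∈ MM)
    (hmax : ∀ ν ∈ MM, objE f θ ν ≤ objE f θ μstar) :
    ∀ ε > 0,
      Tendsto
        (fun n : ℕ => Qprob f θ n
          (fun π => ε < |permStat f n π / n - ∫ p, f p ∂μstar|))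
        atTop (𝓝 0) := by
  intro ε hε
  obtain ⟨F, hF⟩ := exists_boundedContinuous_extension hf.1
  set m := ∫ p, f p ∂μstar with hm
  have hcontF : Continuous fun ν : ProbabilityMeasure (ℝ × ℝ) ↦
      |∫ p, F p ∂(ν : Measure (ℝ × ℝ)) - m| :=
    ((ProbabilityMeasure.continuous_integral_boundedContinuousFunction F).sub
      continuous_const).abs
  set S : Set (ProbabilityMeasure (ℝ × ℝ)) :=
    closure {ν : ProbabilityMeasure (ℝ × ℝ) | (ν : Measure (ℝ × ℝ)) unitSqᶜ = 0} ∩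
      {ν | ε ≤ |∫ p, F p ∂(ν : Measure (ℝ × ℝ)) - m|} with hS
  have hScomp : IsCompact S :=
    isCompact_closure_supported_unitSq.inter_right (isClosed_le continuous_const hcontF)
  have hSprob : Tendsto (fun n : ℕ ↦ Qprob f θ n fun π ↦
      ∃ ν ∈ S, (ν : Measure (ℝ × ℝ)) = permMeasure n π) atTop (𝓝 0) := by
    refine hScomp.induction_on (p := fun s ↦ Tendsto (fun n : ℕ ↦ Qprob f θ n fun π ↦
      ∃ ν ∈ s, (ν : Measure (ℝ × ℝ)) = permMeasure n π) atTop (𝓝 0)) ?_ ?_ ?_ ?_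
    · refine tendsto_const_nhds.congr fun n ↦ (Qprob_eq_zero f θ fun π ↦ ?_).symm
      simp
    · intro s t hst ht
      exact squeeze_zero (fun n ↦ Qprob_nonneg _ _ _ _)
        (fun n ↦ Qprob_mono f θ fun π ⟨ν, hν, h⟩ ↦ ⟨ν, hst hν, h⟩) ht
    · intro s t hs ht
      refine squeeze_zero (fun n ↦ Qprob_nonneg _ _ _ _) (fun n ↦ ?_)
        (by simpa using hs.add ht)
      refine (Qprob_mono f θ fun π ⟨ν, hν, h⟩ ↦ ?_).trans (Qprob_or_le f θ _ _)
      exact hν.imp (fun hν ↦ ⟨ν, hν, h⟩) fun hν ↦ ⟨ν, hν, h⟩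
    · intro ν hν
      obtain ⟨Φ, hΦ, hneg, hne⟩ : ∃ Φ : ProbabilityMeasure (ℝ × ℝ) → ℝ,
          Continuous Φ ∧ Negligible f θ Φ ∧ Φ ν ≠ 0 := by
        by_contra! hall
        have heq := eq_of_forall_negligible hF hμ hmax hall
        have h := hν.2
        simp only [Set.mem_ofPred_eq, ← heq, hm, integral_eq_of_mem_MM hF hμ, sub_self,
          abs_zero] at h
        exact absurd h (not_le.2 hε)
      refine ⟨{η | |Φ ν| / 2 < |Φ η|}, mem_nhdsWithin_of_mem_nhds
        ((isOpen_lt continuous_const hΦ.abs).mem_nhds (half_lt_self (abs_pos.2 hne))), ?_⟩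
      exact hneg _ (half_pos (abs_pos.2 hne))
  refine squeeze_zero' (Eventually.of_forall fun n ↦ Qprob_nonneg _ _ _ _) ?_ hSprob
  filter_upwards [eventually_ne_atTop 0] with n hn
  refine Qprob_mono f θ fun π hπ ↦ ?_
  refine ⟨⟨permMeasure n π, isProbabilityMeasure_permMeasure hn π⟩,
    ⟨subset_closure (permMeasure_compl_unitSq π), ?_⟩, rfl⟩
  have hint : ∫ p, F p ∂permMeasure n π = permStat f n π / n := by
    rw [integral_permMeasure, permStat]
    congr 1
    exact Finset.sum_congr rfl fun i _ ↦ hF _ ⟨div_mem_Icc i, div_mem_Icc (π i)⟩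
  change ε ≤ |∫ p, F p ∂permMeasure n π - m|
  rw [hint]
  exact hπ.le
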